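/- arXiv:1201.2109 — 2 statements merged into one kernel-verified Lean document; each statement's English description precedes it below -/
import Mathlib

section
/- Let u be a recurrent infinite word over A_m, let n ≥ 1, and let B ≥ n be such that every factor of u of length n is a factor of u_[B] and u_[n] is a suffix of u_[B]. Let v be the word obtained from u_[B] by deleting its last n letters and w the word obtained from u_[B] by deleting its first n letters. Suppose z_0, z_1, …, z_h and z̃_0, z̃_1, …, z̃_h are nonempty finite words with v = z_0 z_1 ⋯ z_h, w = z̃_0 z̃_1 ⋯ z̃_h, and Ψ(z_j) = Ψ(z̃_j) for every j. Then P^rel_u(n) = ⋃_{j=0}^{h} { Ψ(s) − Ψ(r) : r is a prefix of z_j, s is a prefix of z̃_j, and |r| = |s| }. -/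
/-- The prefix of length `n` of the infinite word `u`. -/
def pref (u : ℕ → ℕ) (n : ℕ) : List ℕ := (List.range n).map u

/-- `w` is a factor of the infinite word `u`. -/
def IsFactor (u : ℕ → ℕ) (w : List ℕ) : Prop :=
  ∃ i : ℕ, w = (List.range w.length).map (fun j => u (i + j))

/-- The Parikh vector of `w`, viewed as a word over `{0, …, m-1}`. -/
def parikh (m : ℕ) (w : List ℕ) : Fin m → ℤ := fun ℓ => (w.count (ℓ : ℕ) : ℤ)

/-- The set of relative Parikh vectors of factors of `u` of length `n`. -/
def relParikhSet (m : ℕ) (u : ℕ → ℕ) (n : ℕ) : Set (Fin m → ℤ) :=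
  { v | ∃ w : List ℕ, IsFactor u w ∧ w.length = n ∧ v = parikh m w - parikh m (pref u n) }

/-- The extension of a substitution `φ` to finite words. -/
def substW (φ : ℕ → List ℕ) (w : List ℕ) : List ℕ := w.flatMap φ

/-- The `k`-th iterate of the substitution `φ`, applied to the word `w`. -/
def iterW (φ : ℕ → List ℕ) (k : ℕ) (w : List ℕ) : List ℕ := (substW φ)^[k] w

/-- `u` is recurrent: every factor occurs at infinitely many positions. -/
def Recurrent (u : ℕ → ℕ) : Prop :=
  ∀ w : List ℕ, IsFactor u w →
    ∀ N : ℕ, ∃ i, N ≤ i ∧ w = (List.range w.length).map (fun j => u (i + j))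

theorem parikh_append (m : ℕ) (a b : List ℕ) :
    parikh m (a ++ b) = parikh m a + parikh m b := by
  funext ℓ
  simp [parikh]

/-- A word over `{0, …, m-1}` has length equal to the sum of its Parikh vector. -/
theorem sum_parikh (m : ℕ) (w : List ℕ) (hw : ∀ x ∈ w, x < m) :
    ∑ ℓ, parikh m w ℓ = w.length := by
  have h1 := Multiset.sum_count_eq_card (s := Finset.range m) (m := (w : Multiset ℕ))
    (by simpa using hw)
  simp only [Multiset.coe_count, Multiset.coe_card] at h1
  rw [← h1, Finset.sum_range]
  simp [parikh]

theorem exists_take_flatten_ofFn (m k : ℕ) (z zt : Fin k → List ℕ)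
    (hlen : ∀ j, (z j).length = (zt j).length)
    (hpsi : ∀ j, parikh m (z j) = parikh m (zt j)) (j : Fin k) (t : ℕ)
    (ht : t ≤ (z j).length) :
    ∃ i, parikh m ((List.ofFn zt).flatten.take i) - parikh m ((List.ofFn z).flatten.take i)
      = parikh m ((zt j).take t) - parikh m ((z j).take t) := by
  induction k with
  | zero => exact j.elim0
  | succ k ih =>
    induction j using Fin.cases with
    | zero =>
      refine ⟨t, ?_⟩
      simp only [List.ofFn_succ, List.flatten_cons]
      rw [List.take_append_of_le_length ht, List.take_append_of_le_length (hlen 0 ▸ ht)]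
    | succ j =>
      obtain ⟨i, hi⟩ := ih (fun j => z j.succ) (fun j => zt j.succ) (fun j => hlen _)
        (fun j => hpsi _) j ht
      refine ⟨(z 0).length + i, ?_⟩
      rw [← hi]
      simp only [List.ofFn_succ, List.flatten_cons]
      rw [List.take_length_add_append, hlen 0, List.take_length_add_append, parikh_append,
        parikh_append, hpsi 0]
      abel

theorem exists_take_of_take_flatten_ofFn (m k : ℕ) (z zt : Fin (k + 1) → List ℕ)
    (hlen : ∀ j, (z j).length = (zt j).length)
    (hpsi : ∀ j, parikh m (z j) = parikh m (zt j)) (i : ℕ) :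
    ∃ j t, parikh m ((List.ofFn zt).flatten.take i) - parikh m ((List.ofFn z).flatten.take i)
      = parikh m ((zt j).take t) - parikh m ((z j).take t) := by
  induction k generalizing i with
  | zero => exact ⟨0, i, by simp⟩
  | succ k ih =>
    rw [List.ofFn_succ, List.ofFn_succ (f := z), List.flatten_cons, List.flatten_cons]
    rcases le_total i (z 0).length with hi | hi
    · exact ⟨0, i, by
        rw [List.take_append_of_le_length hi, List.take_append_of_le_length (hlen 0 ▸ hi)]⟩
    · obtain ⟨i, rfl⟩ := Nat.exists_eq_add_of_le hi
      obtain ⟨j, t, h⟩ := ih (fun j => z j.succ) (fun j => zt j.succ) (fun j => hlen _)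
        (fun j => hpsi _) i
      refine ⟨j.succ, t, ?_⟩
      rw [← h, List.take_length_add_append, hlen 0, List.take_length_add_append, parikh_append,
        parikh_append, hpsi 0]
      abel

/-- Sliding a window of length `n` from the start of `P` to position `i` changes its Parikh
vector by the difference of the prefixes of length `i` of `P` with and without its first `n`
letters. -/
theorem parikh_window (m : ℕ) (P : List ℕ) (n i : ℕ) :
    parikh m ((P.drop i).take n) - parikh m (P.take n)
      = parikh m ((P.drop n).take i) - parikh m (P.take i) := by
  rw [sub_eq_sub_iff_add_eq_add, add_comm, ← parikh_append, add_comm, ← parikh_append,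
    ← List.take_add, ← List.take_add, add_comm]

theorem mem_relParikhSet_iff (m : ℕ) (u : ℕ → ℕ) (n B : ℕ) (hB : n ≤ B)
    (hBfac : ∀ w : List ℕ, IsFactor u w → w.length = n → w <:+: pref u B)
    (d : Fin m → ℤ) :
    d ∈ relParikhSet m u n ↔ ∃ i, d = parikh m (((pref u B).drop n).take i)
      - parikh m (((pref u B).take (B - n)).take i) := by
  have hlen : (pref u B).length = B := by simp [pref]
  have hpre : (pref u B).take n = pref u n := by
    simp [pref, ← List.map_take, List.take_range, hB]
  constructor
  · rintro ⟨w, hw, hwn, rfl⟩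
    obtain ⟨a, b, hab⟩ := hBfac w hw hwn
    have hl := congrArg List.length hab
    simp only [List.length_append, hlen] at hl
    refine ⟨a.length, ?_⟩
    rw [List.take_take, min_eq_left (by omega), ← parikh_window, hpre, ← hab, ← hwn]
    simp
  · rintro ⟨i, rfl⟩
    have hi : ((pref u B).drop n).take i = ((pref u B).drop n).take (min i (B - n)) := by
      rw [← List.take_take, List.take_of_length_le (i := B - n)]
      simp [hlen]
    rw [hi, List.take_take, ← parikh_window, hpre]
    refine ⟨_, ⟨min i (B - n), ?_⟩, ?_, rfl⟩
    · apply List.ext_getElem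
      · simp
      · intro k h1 h2
        simp [pref]
    · simp [hlen]
      omega

theorem stmt4 (m : ℕ) (hm : 1 ≤ m) (u : ℕ → ℕ) (hu : ∀ i, u i < m)
    (hrec : Recurrent u) (n : ℕ) (hn : 1 ≤ n) (B : ℕ) (hB : n ≤ B)
    (hBfac : ∀ w : List ℕ, IsFactor u w → w.length = n → w <:+: pref u B)
    (hBsuf : pref u n <:+ pref u B)
    (h : ℕ) (z zt : Fin (h + 1) → List ℕ)
    (hzne : ∀ j, z j ≠ []) (hztne : ∀ j, zt j ≠ [])
    (hzv : (List.ofFn z).flatten = (pref u B).take (B - n))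
    (hztw : (List.ofFn zt).flatten = (pref u B).drop n)
    (hpsi : ∀ j, parikh m (z j) = parikh m (zt j)) :
    relParikhSet m u n =
      ⋃ j : Fin (h + 1), { d : Fin m → ℤ | ∃ r s : List ℕ,
        r <+: z j ∧ s <+: zt j ∧ r.length = s.length ∧
        d = parikh m s - parikh m r } := by
  have hmem : ∀ x ∈ pref u B, x < m := by
    intro x hx
    obtain ⟨i, -, rfl⟩ := List.mem_map.1 hx
    exact hu i
  have hlen : ∀ j, (z j).length = (zt j).length := by
    intro j
    have h1 : ∀ x ∈ z j, x < m := fun x hx => hmem x <| List.mem_of_mem_take <|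
      hzv ▸ List.mem_flatten_of_mem (List.mem_ofFn.2 ⟨j, rfl⟩) hx
    have h2 : ∀ x ∈ zt j, x < m := fun x hx => hmem x <| List.mem_of_mem_drop <|
      hztw ▸ List.mem_flatten_of_mem (List.mem_ofFn.2 ⟨j, rfl⟩) hx
    have := sum_parikh m _ h1
    rw [hpsi j, sum_parikh m _ h2] at this
    exact_mod_cast this.symm
  ext d
  rw [mem_relParikhSet_iff m u n B hB hBfac, ← hzv, ← hztw]
  simp only [Set.mem_iUnion, Set.mem_ofPred_eq]
  constructor
  · rintro ⟨i, rfl⟩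
    obtain ⟨j, t, ht⟩ := exists_take_of_take_flatten_ofFn m h z zt hlen hpsi i
    exact ⟨j, _, _, List.take_prefix t _, List.take_prefix t _, by simp [hlen j], ht⟩
  · rintro ⟨j, r, s, hr, hs, hrs, rfl⟩
    obtain ⟨i, hi⟩ := exists_take_flatten_ofFn m _ z zt hlen hpsi j r.length hr.length_le
    refine ⟨i, ?_⟩
    rw [hi, ← List.prefix_iff_eq_take.1 hr, hrs, ← List.prefix_iff_eq_take.1 hs]
end

section
/- Let u be the simple Parry word associated with the substitution φ. If w is a factor of u with |w| ≤ F_k for some k ∈ ℕ, then there exists a finite word t with |t|_0 = 0 (t may be empty) such that 0t0 is a factor of u and w is a factor of φ^k(0t0). -/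
theorem substW_append (φ : ℕ → List ℕ) (v w : List ℕ) :
    substW φ (v ++ w) = substW φ v ++ substW φ w := by
  simp [substW]

theorem iterW_append (φ : ℕ → List ℕ) (k : ℕ) (v w : List ℕ) :
    iterW φ k (v ++ w) = iterW φ k v ++ iterW φ k w := by
  induction k generalizing v w with
  | zero => rfl
  | succ k ih => simpa only [iterW, Function.iterate_succ_apply, substW_append] using ih _ _

theorem iterW_add (φ : ℕ → List ℕ) (k n : ℕ) (w : List ℕ) :
    iterW φ (k + n) w = iterW φ k (iterW φ n w) :=
  Function.iterate_add_apply _ _ _ _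

theorem iterW_succ (φ : ℕ → List ℕ) (k : ℕ) (w : List ℕ) :
    iterW φ (k + 1) w = substW φ (iterW φ k w) :=
  Function.iterate_succ_apply' _ _ _

/-- The block of `n` letters of `u` starting at position `i`. -/
def block (u : ℕ → ℕ) (i n : ℕ) : List ℕ := (List.range n).map fun j => u (i + j)

@[simp]
theorem length_block (u : ℕ → ℕ) (i n : ℕ) : (block u i n).length = n := by simp [block]

@[simp]
theorem length_pref (u : ℕ → ℕ) (n : ℕ) : (pref u n).length = n := by simp [pref]

theorem isFactor_block (u : ℕ → ℕ) (i n : ℕ) : IsFactor u (block u i n) :=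
  ⟨i, by simp [block]⟩

theorem block_add (u : ℕ → ℕ) (i a b : ℕ) :
    block u i (a + b) = block u i a ++ block u (i + a) b := by
  simp [block, List.range_add, Function.comp_def, add_assoc]

theorem pref_add (u : ℕ → ℕ) (a b : ℕ) : pref u (a + b) = pref u a ++ block u a b := by
  simp [pref, block, List.range_add, Function.comp_def]

theorem block_one (u : ℕ → ℕ) (i : ℕ) : block u i 1 = [u i] := by simp [block]

theorem lt_of_mem_pref {m : ℕ} {u : ℕ → ℕ} (hu : ∀ i, u i < m) (n : ℕ) :
    ∀ x ∈ pref u n, x < m := by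
  simp [pref, hu]

section Substitution

variable {m : ℕ} {φ : ℕ → List ℕ}

theorem lt_of_mem_substW (hclosed : ∀ ℓ < m, ∀ x ∈ φ ℓ, x < m) {w : List ℕ}
    (hw : ∀ x ∈ w, x < m) : ∀ x ∈ substW φ w, x < m := by
  intro x hx
  obtain ⟨y, hy, hxy⟩ := List.mem_flatMap.1 hx
  exact hclosed y (hw y hy) x hxy

theorem lt_of_mem_iterW (hclosed : ∀ ℓ < m, ∀ x ∈ φ ℓ, x < m) (k : ℕ) {w : List ℕ}
    (hw : ∀ x ∈ w, x < m) : ∀ x ∈ iterW φ k w, x < m := by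
  induction k with
  | zero => exact hw
  | succ k ih => rw [iterW_succ]; exact lt_of_mem_substW hclosed ih

theorem length_le_length_substW (hne : ∀ ℓ < m, φ ℓ ≠ []) {w : List ℕ}
    (hw : ∀ x ∈ w, x < m) : w.length ≤ (substW φ w).length := by
  induction w with
  | nil => simp
  | cons a w ih =>
    have h₁ := List.length_pos_iff.2 (hne a (hw a (by simp)))
    have h₂ := ih fun x hx => hw x (by simp [hx])
    simp only [substW, List.flatMap_cons, List.length_append, List.length_cons] at h₂ ⊢
    omega

theorem length_le_length_iterW (hclosed : ∀ ℓ < m, ∀ x ∈ φ ℓ, x < m)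
    (hne : ∀ ℓ < m, φ ℓ ≠ []) (k : ℕ) {w : List ℕ} (hw : ∀ x ∈ w, x < m) :
    w.length ≤ (iterW φ k w).length := by
  induction k with
  | zero => exact le_rfl
  | succ k ih =>
    rw [iterW_succ]
    exact ih.trans (length_le_length_substW hne (lt_of_mem_iterW hclosed k hw))

/-- If the image of `0` starts with `0` and is longer than one letter, the iterates grow. -/
theorem lt_length_iterW_zero (hclosed : ∀ ℓ < m, ∀ x ∈ φ ℓ, x < m)
    (hne : ∀ ℓ < m, φ ℓ ≠ []) (hm : 0 < m) {v : List ℕ} (hv : v ≠ [])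
    (h0 : φ 0 = [0] ++ v) (k : ℕ) : k < (iterW φ k [0]).length := by
  induction k with
  | zero => simp [iterW]
  | succ k ih =>
    have h : iterW φ (k + 1) [0] = iterW φ k [0] ++ iterW φ k v := by
      rw [iterW_add, ← iterW_append, ← h0]; simp [iterW, substW]
    have hvm : ∀ x ∈ v, x < m := fun x hx => hclosed 0 hm x (by simp [h0, hx])
    have := length_le_length_iterW hclosed hne k hvm
    have := List.length_pos_iff.2 hv
    rw [h, List.length_append]
    omega

/-- The word `u` is fixed by every iterate of the substitution. -/
theorem iterW_pref {u : ℕ → ℕ} (hgrow : ∀ k, k < (iterW φ k [0]).length)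
    (hufix : ∀ k : ℕ, iterW φ k [0] = pref u (iterW φ k [0]).length) (k n : ℕ) :
    iterW φ k (pref u n) = pref u (iterW φ k (pref u n)).length := by
  obtain ⟨d, hd⟩ := Nat.exists_eq_add_of_lt (hgrow n)
  have h₁ := hufix (k + n)
  rw [iterW_add, hufix n, hd, add_assoc, pref_add, iterW_append, List.length_append,
    pref_add] at h₁
  exact (List.append_inj h₁ (by simp)).1

theorem zero_mem_substW (h0 : 0 ∈ φ 0) {w : List ℕ} (hw : 0 ∈ w) : 0 ∈ substW φ w :=
  List.mem_flatMap.2 ⟨0, hw, h0⟩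

theorem zero_mem_iterW (h0 : 0 ∈ φ 0) (hlast : 0 ∈ φ (m - 1))
    (hstep : ∀ ℓ, ℓ + 1 < m → ℓ + 1 ∈ φ ℓ) {ℓ : ℕ} (hℓ : ℓ < m) :
    0 ∈ iterW φ m [ℓ] := by
  have key : ∀ k, 0 ∈ iterW φ k [ℓ] ∨ (ℓ + k < m ∧ ℓ + k ∈ iterW φ k [ℓ]) := by
    intro k
    induction k with
    | zero => right; simpa [iterW] using hℓ
    | succ k ih =>
      rw [iterW_succ]
      rcases ih with h | ⟨hlt, h⟩
      · exact Or.inl (zero_mem_substW h0 h)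
      · by_cases hk : ℓ + k + 1 < m
        · exact Or.inr ⟨hk, List.mem_flatMap.2 ⟨_, h, hstep _ hk⟩⟩
        · refine Or.inl (List.mem_flatMap.2 ⟨_, h, ?_⟩)
          rwa [show ℓ + k = m - 1 by omega]
  rcases key m with h | ⟨h, -⟩
  · exact h
  · omega

theorem iterW_block {u : ℕ → ℕ} {k : ℕ}
    (hfix : ∀ n, iterW φ k (pref u n) = pref u (iterW φ k (pref u n)).length) (i n : ℕ) :
    iterW φ k (block u i n) =
      block u (iterW φ k (pref u i)).length (iterW φ k (block u i n)).length := by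
  have h := hfix (i + n)
  rw [pref_add, iterW_append, List.length_append, pref_add] at h
  exact (List.append_inj h (by simp)).2

theorem exists_zero_ge {u : ℕ → ℕ} (hu : ∀ i, u i < m)
    (hclosed : ∀ ℓ < m, ∀ x ∈ φ ℓ, x < m) (hne : ∀ ℓ < m, φ ℓ ≠ [])
    (hfix : ∀ n, iterW φ m (pref u n) = pref u (iterW φ m (pref u n)).length)
    (hzero : ∀ ℓ < m, 0 ∈ iterW φ m [ℓ]) (n : ℕ) : ∃ j, n ≤ j ∧ u j = 0 := by
  have h := hzero (u n) (hu n)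
  rw [← block_one, iterW_block hfix] at h
  obtain ⟨j, -, hj⟩ := List.mem_map.1 h
  refine ⟨_, ?_, hj⟩
  have := length_le_length_iterW hclosed hne m (lt_of_mem_pref hu n)
  rw [length_pref] at this
  omega

end Substitution

theorem block_infix_block (u : ℕ → ℕ) {i n p l : ℕ} (hp : i ≤ p) (hl : p + l ≤ i + n) :
    block u p l <:+: block u i n := by
  obtain ⟨a, rfl⟩ := Nat.exists_eq_add_of_le hp
  obtain ⟨b, hb⟩ := Nat.exists_eq_add_of_le (show a + l ≤ n by omega)
  exact ⟨block u i a, block u (i + (a + l)) b, by rw [hb, block_add, block_add]⟩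

theorem stmt5
    (m : ℕ) (hm : 2 ≤ m) (α : ℕ → ℕ) (hα0 : 1 ≤ α 0)
    (hαle : ∀ ℓ, ℓ < m → α ℓ ≤ α 0) (hαlast : 1 ≤ α (m - 1))
    (φ : ℕ → List ℕ)
    (hφ : ∀ ℓ, ℓ + 1 < m → φ ℓ = List.replicate (α ℓ) 0 ++ [ℓ + 1])
    (hφlast : φ (m - 1) = List.replicate (α (m - 1)) 0)
    (u : ℕ → ℕ) (hu : ∀ i, u i < m)
    (hufix : ∀ k : ℕ, iterW φ k [0] = pref u (iterW φ k [0]).length)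
    (w : List ℕ) (hw : IsFactor u w) (k : ℕ)
    (hlen : w.length ≤ (iterW φ k [0]).length) :
    ∃ t : List ℕ, t.count 0 = 0 ∧ IsFactor u ([0] ++ t ++ [0]) ∧
      w <:+: iterW φ k ([0] ++ t ++ [0]) := by
  have h0 : φ 0 = [0] ++ (List.replicate (α 0 - 1) 0 ++ [1]) := by
    obtain ⟨a, ha⟩ := Nat.exists_eq_add_of_le' hα0
    rw [hφ 0 (by omega), ha]
    simp [List.replicate_succ]
  have hcases : ∀ ℓ < m, ℓ + 1 < m ∨ ℓ = m - 1 := fun ℓ h => by omega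
  have hclosed : ∀ ℓ < m, ∀ x ∈ φ ℓ, x < m := by
    intro ℓ hℓ x hx
    rcases hcases ℓ hℓ with h | rfl
    · rw [hφ ℓ h, List.mem_append, List.mem_replicate, List.mem_singleton] at hx
      omega
    · rw [hφlast, List.mem_replicate] at hx
      omega
  have hlast : 0 ∈ φ (m - 1) := by
    rw [hφlast, List.mem_replicate]
    exact ⟨by omega, rfl⟩
  have hstep : ∀ ℓ, ℓ + 1 < m → ℓ + 1 ∈ φ ℓ := fun ℓ h => by simp [hφ ℓ h]
  have hne : ∀ ℓ < m, φ ℓ ≠ [] := by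
    intro ℓ hℓ
    rcases hcases ℓ hℓ with h | rfl
    · exact List.ne_nil_of_mem (hstep ℓ h)
    · exact List.ne_nil_of_mem hlast
  have hfix := iterW_pref
    (lt_length_iterW_zero hclosed hne (by omega) (by simp) h0) hufix
  have hinf := exists_zero_ge hu hclosed hne (hfix m) fun ℓ hℓ =>
    zero_mem_iterW (by simp [h0]) hlast hstep hℓ
  have hu0 : u 0 = 0 := by simpa [iterW, pref] using (hufix 0).symm
  obtain ⟨p, hp⟩ := hw
  change w = block u p w.length at hp
  set L : ℕ → ℕ := fun n => (iterW φ k (pref u n)).length with hL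
  have hLge : ∀ n, n ≤ L n := fun n => by
    simpa using length_le_length_iterW hclosed hne k (lt_of_mem_pref hu n)
  -- `j` is the first zero whose image starts after position `p`, and `i` the zero preceding it.
  have hex : ∃ j, u j = 0 ∧ p < L j := by
    obtain ⟨j, hj, hj0⟩ := hinf (p + 1)
    exact ⟨j, hj0, lt_of_lt_of_le hj (hLge j)⟩
  obtain ⟨j, ⟨hj0, hjp⟩, hjmin⟩ : ∃ j, (u j = 0 ∧ p < L j) ∧ ∀ i < j, u i = 0 → L i ≤ p :=
    ⟨Nat.find hex, Nat.find_spec hex, fun i hi h0 =>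
      not_lt.1 fun h => Nat.find_min hex hi ⟨h0, h⟩⟩
  have hjpos : 0 < j := by
    rcases Nat.eq_zero_or_pos j with rfl | h
    · simp [hL, pref, iterW, Function.iterate_fixed (f := substW φ) (x := []) rfl] at hjp
    · exact h
  obtain ⟨i, hi0, hij, hmax⟩ :
      ∃ i, u i = 0 ∧ i ≤ j - 1 ∧ ∀ x, i < x → x < j → u x ≠ 0 :=
    ⟨Nat.findGreatest (fun i => u i = 0) (j - 1),
      Nat.findGreatest_spec (P := fun i => u i = 0) (Nat.zero_le _) hu0,
      Nat.findGreatest_le _, fun x h₁ h₂ =>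
        Nat.findGreatest_is_greatest (P := fun i => u i = 0) h₁ (by omega)⟩
  obtain ⟨d, rfl⟩ : ∃ d, j = i + (1 + d) := ⟨j - 1 - i, by omega⟩
  have hdecomp : [0] ++ block u (i + 1) d ++ [0] = block u i (1 + d + 1) := by
    rw [block_add, block_add, block_one, block_one, hi0, hj0]
  refine ⟨block u (i + 1) d, ?_, hdecomp ▸ isFactor_block _ _ _, ?_⟩
  · rw [List.count_eq_zero]
    intro h
    obtain ⟨x, hx, hx0⟩ := List.mem_map.1 h
    rw [List.mem_range] at hx
    exact hmax _ (by omega) (by omega) hx0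
  · rw [hdecomp, hp, iterW_block (hfix k)]
    refine block_infix_block u (hjmin i (by omega) hi0) ?_
    have hlenL : L (i + (1 + d)) = L i + (iterW φ k (block u i (1 + d))).length := by
      simp only [hL, pref_add, iterW_append, List.length_append]
    rw [block_add, block_one, hj0, iterW_append, List.length_append]
    change p + w.length ≤ L i + _
    omega
end
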